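/- arXiv:1710.11484 — 5 statements merged into one kernel-verified Lean document; each statement's English description precedes it below -/
import Mathlib

section
/- Let p be a prime and let α_p := ∑' (n : ℕ), (p : ℤ_p)^(v_p(n!)) be the sum in ℤ_p of the series ∑_{n=0}^∞ p^{v_p(n!)}. Then α_p is irrational: there is no rational number q such that the image of α_p in ℚ_p equals the image of q in ℚ_p. -/
open Nat

theorem aux_mono (p : ℕ) [Fact p.Prime] : Monotone (fun n : ℕ => padicValNat p (n !)) := by
  intro a b hab
  exact (padicValNat_dvd_iff_le (Nat.factorial_ne_zero b)).1
    (pow_padicValNat_dvd.trans (Nat.factorial_dvd_factorial hab))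

theorem aux_summable (p : ℕ) [hp : Fact p.Prime] :
    Summable (fun n : ℕ => (p : ℤ_[p]) ^ (padicValNat p (n !))) := by
  apply NonarchimedeanAddGroup.summable_of_tendsto_cofinite_zero
  rw [Nat.cofinite_eq_atTop]
  have h1 : Filter.Tendsto (fun n : ℕ => (p : ℤ_[p]) ^ n) Filter.atTop (nhds 0) := by
    apply tendsto_pow_atTop_nhds_zero_of_norm_lt_one
    rw [PadicInt.norm_p]
    exact inv_lt_one_of_one_lt₀ (by exact_mod_cast hp.out.one_lt)
  refine h1.comp (Filter.tendsto_atTop_atTop_of_monotone (aux_mono p) ?_)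
  intro b
  exact ⟨p * b, by simp only [padicValNat_factorial_mul]; omega⟩

theorem aux_tail (p : ℕ) [hp : Fact p.Prime] (N : ℕ) :
    ‖(∑' n : ℕ, (p : ℤ_[p]) ^ (padicValNat p (n !)))
      - ((∑ n ∈ Finset.range N, p ^ (padicValNat p (n !)) : ℕ) : ℤ_[p])‖
      ≤ (p : ℝ) ^ (-(padicValNat p (N !) : ℤ)) := by
  rw [← (aux_summable p).sum_add_tsum_nat_add N]
  simp only [Nat.cast_sum, Nat.cast_pow]
  rw [add_sub_cancel_left]
  refine (IsUltrametricDist.norm_tsum_le _).trans (ciSup_le fun n => ?_)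
  rw [PadicInt.norm_p_pow]
  have h1 : (1 : ℝ) ≤ p := by exact_mod_cast hp.out.one_le
  apply zpow_le_zpow_right₀ h1
  have := aux_mono p (Nat.le_add_left N n)
  simp only at this
  omega

theorem aux_bound (p : ℕ) [hp : Fact p.Prime] (M : ℕ) :
    ∑ n ∈ Finset.range (p * (M + 1)), p ^ (padicValNat p (n !))
      ≤ 2 * p * p ^ (padicValNat p ((p * M)!)) := by
  have step : ∀ M, ∑ n ∈ Finset.range (p * (M + 1)), p ^ (padicValNat p (n !)) =
      ∑ n ∈ Finset.range (p * M), p ^ (padicValNat p (n !)) +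
        p * p ^ (padicValNat p ((p * M)!)) := by
    intro M
    rw [mul_add, mul_one, Finset.sum_range_add]
    congr 1
    rw [Finset.sum_congr rfl (g := fun _ => p ^ (padicValNat p ((p * M)!)))]
    · simp
    · intro x hx
      rw [padicValNat_factorial_mul_add M (Finset.mem_range.1 hx)]
  induction M with
  | zero => rw [step]; simp; omega
  | succ M ih =>
    rw [step]
    have h2 : padicValNat p ((p * M)!) + 1 ≤ padicValNat p ((p * (M + 1))!) := by
      rw [padicValNat_factorial_mul, padicValNat_factorial_mul]
      have := aux_mono p (Nat.le_succ M)
      simp only [Nat.succ_eq_add_one] at this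
      omega
    have h3 : 2 * p ^ (padicValNat p ((p * M)!)) ≤ p ^ (padicValNat p ((p * (M + 1))!)) := by
      calc _ ≤ p * p ^ (padicValNat p ((p * M)!)) := Nat.mul_le_mul_right _ hp.out.two_le
        _ = p ^ (padicValNat p ((p * M)!) + 1) := by ring
        _ ≤ _ := Nat.pow_le_pow_right hp.out.pos h2
    have h4 := Nat.mul_le_mul_left p h3
    nlinarith

theorem aux_jump (p : ℕ) [hp : Fact p.Prime] (k M : ℕ) (h : M + 1 = p ^ k) :
    padicValNat p ((p * (M + 1))!) = padicValNat p ((p * M)!) + (k + 1) := by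
  rw [padicValNat_factorial_mul, padicValNat_factorial_mul, Nat.factorial_succ,
    padicValNat.mul (by omega) (Nat.factorial_ne_zero M)]
  rw [h, padicValNat.prime_pow]
  omega

theorem aux_eq (p : ℕ) [hp : Fact p.Prime] (q : ℚ)
    (hq : ((∑' n : ℕ, (p : ℤ_[p]) ^ (padicValNat p (n !)) : ℤ_[p]) : ℚ_[p]) = (q : ℚ_[p]))
    (k : ℕ) (hk : q.num.natAbs + 2 * p * q.den ≤ k) :
    q.num = q.den * ((∑ n ∈ Finset.range (p * p ^ k), p ^ (padicValNat p (n !)) : ℕ) : ℤ) := by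
  obtain ⟨M, hM⟩ : ∃ M, M + 1 = p ^ k := ⟨p ^ k - 1, Nat.sub_add_cancel (Nat.pow_pos hp.out.pos)⟩
  rw [← hM]
  have hb := aux_bound p M
  have ht := aux_tail p (p * (M + 1))
  have hj := aux_jump p k M hM
  set α := (∑' n : ℕ, (p : ℤ_[p]) ^ (padicValNat p (n !)) : ℤ_[p])
  set T := ∑ n ∈ Finset.range (p * (M + 1)), p ^ (padicValNat p (n !))
  have hα : (q.den : ℤ_[p]) * α = (q.num : ℤ_[p]) := by
    apply Subtype.ext
    push_cast
    rw [hq]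
    exact_mod_cast Rat.den_mul_eq_num q
  have hdvd : (p : ℤ) ^ (padicValNat p ((p * (M + 1))!)) ∣ q.num - q.den * (T : ℤ) := by
    rw [← PadicInt.norm_int_le_pow_iff_dvd]
    simp only [Int.cast_sub, Int.cast_mul, Int.cast_natCast]
    rw [← hα, ← mul_sub, norm_mul]
    calc _ ≤ 1 * ‖α - (T : ℤ_[p])‖ :=
          mul_le_mul_of_nonneg_right (PadicInt.norm_le_one _) (norm_nonneg _)
      _ ≤ _ := by rw [one_mul]; exact ht
  have hlt : |q.num - q.den * (T : ℤ)| < (p : ℤ) ^ (padicValNat p ((p * (M + 1))!)) := by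
    rw [hj, pow_add]
    set P := p ^ (padicValNat p ((p * M)!)) with hP
    have hP1 : 1 ≤ P := Nat.pow_pos hp.out.pos
    have h1 : |q.num - q.den * (T : ℤ)| ≤ ((q.num.natAbs + q.den * T : ℕ) : ℤ) := by
      push_cast
      refine (abs_sub _ _).trans ?_
      rw [abs_mul]
      simp
    have h2 : q.num.natAbs + q.den * T < P * p ^ (k + 1) := by
      have h3 : k + 1 < p ^ (k + 1) := Nat.lt_pow_self hp.out.one_lt
      calc q.num.natAbs + q.den * T ≤ P * q.num.natAbs + q.den * (2 * p * P) :=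
            Nat.add_le_add (Nat.le_mul_of_pos_left _ hP1) (Nat.mul_le_mul_left _ hb)
        _ = P * (q.num.natAbs + 2 * p * q.den) := by ring
        _ < P * p ^ (k + 1) := Nat.mul_lt_mul_of_pos_left (by omega) hP1
    have h4 : ((q.num.natAbs + q.den * T : ℕ) : ℤ) < ((P * p ^ (k + 1) : ℕ) : ℤ) := by
      exact_mod_cast h2
    rw [hP] at h4
    push_cast at h1 h4 ⊢
    exact lt_of_le_of_lt h1 h4
  have := Int.eq_zero_of_abs_lt_dvd hdvd hlt
  linarith

theorem padic_series_sum_irrational (p : ℕ) [Fact p.Prime] :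
    ¬ ∃ q : ℚ, ((∑' n : ℕ, (p : ℤ_[p]) ^ (padicValNat p (n !)) : ℤ_[p]) : ℚ_[p]) =
      (q : ℚ_[p]) := by
  rintro ⟨q, hq⟩
  have hp : p.Prime := Fact.out
  set k := q.num.natAbs + 2 * p * q.den with hk
  have h1 := aux_eq p q hq k le_rfl
  have h2 := aux_eq p q hq (k + 1) (by omega)
  rw [h1] at h2
  have hd : (q.den : ℤ) ≠ 0 := by exact_mod_cast q.den_nz
  have h3 := mul_left_cancel₀ hd h2
  have h4 : p * p ^ k < p * p ^ (k + 1) :=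
    Nat.mul_lt_mul_of_pos_left (Nat.pow_lt_pow_right hp.one_lt (Nat.lt_succ_self k)) hp.pos
  have h5 : ∑ n ∈ Finset.range (p * p ^ k), p ^ (padicValNat p (n !)) <
      ∑ n ∈ Finset.range (p * p ^ (k + 1)), p ^ (padicValNat p (n !)) := by
    apply Finset.sum_lt_sum_of_subset (i := p * p ^ k)
    · exact Finset.range_subset_range.2 h4.le
    · exact Finset.mem_range.2 h4
    · simp
    · exact Nat.pow_pos hp.pos
    · intros; exact Nat.zero_le _
  have h6 := Nat.cast_injective h3
  omega
end

section
/- Let p be a prime and k : ℕ. Then ∑_{m = k·p}^{(k+1)·p − 1} p^{v_p(m!)} = p^{v_p((k·p)!) + 1} (as natural numbers); in other words, adding the p equal terms of the k-th package produces exactly one carry. -/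
open Nat

theorem package_sum_eq_pow_succ (p : ℕ) (hp : p.Prime) (k : ℕ) :
    ∑ m ∈ Finset.Icc (k * p) ((k + 1) * p - 1), p ^ (padicValNat p (m !)) =
      p ^ (padicValNat p ((k * p)!) + 1) := by
  haveI : Fact p.Prime := ⟨hp⟩
  have hpos := hp.pos
  have hk : (k + 1) * p = k * p + p := by ring
  have h : ∀ m ∈ Finset.Icc (k * p) ((k + 1) * p - 1),
      p ^ (padicValNat p (m !)) = p ^ (padicValNat p ((k * p)!)) := by
    intro m hm
    rw [Finset.mem_Icc] at hm
    obtain ⟨r, rfl⟩ := Nat.exists_eq_add_of_le hm.1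
    have hr : r < p := by omega
    rw [mul_comm k p, padicValNat_factorial_mul_add k hr]
  have hc : (k + 1) * p - 1 + 1 - k * p = p := by omega
  rw [Finset.sum_congr rfl h, Finset.sum_const, Nat.card_Icc, hc, smul_eq_mul, pow_succ, mul_comm]
end

section
/- Let p be a prime, k : ℕ, and let n = (k+1)·p − 1 be the largest number in the k-th package. Then the number of base-p digits of the partial sum ∑_{m=0}^{n} p^{v_p(m!)} is equal to v_p(n!) + 2; that is, (Nat.digits p (∑_{m=0}^{n} p^{v_p(m!)})).length = v_p(n!) + 2. -/
open Nat

theorem aux_block (p : ℕ) [hp : Fact p.Prime] (j : ℕ) :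
    ∑ m ∈ Finset.range (p * (j + 1)), p ^ (padicValNat p (m !)) =
      ∑ m ∈ Finset.range (p * j), p ^ (padicValNat p (m !)) +
        p * p ^ (padicValNat p ((p * j) !)) := by
  rw [Nat.mul_succ, Finset.sum_range_add]
  congr 1
  rw [Finset.sum_congr rfl (g := fun _ => p ^ (padicValNat p ((p * j) !)))]
  · simp
  · intro x hx
    rw [padicValNat_factorial_mul_add j (Finset.mem_range.1 hx)]

theorem aux_mono_s5 (p : ℕ) [hp : Fact p.Prime] (j : ℕ) :
    padicValNat p ((p * j) !) + 1 ≤ padicValNat p ((p * (j + 1)) !) := by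
  rw [padicValNat_factorial_mul, padicValNat_factorial_mul, Nat.factorial_succ,
    padicValNat.mul (by omega) (Nat.factorial_ne_zero j)]
  omega

theorem aux_lt (p : ℕ) [hp : Fact p.Prime] (k : ℕ) :
    ∑ m ∈ Finset.range (p * (k + 1)), p ^ (padicValNat p (m !)) <
      p ^ (padicValNat p ((p * k) !) + 2) := by
  have h2 := hp.out.two_le
  induction k with
  | zero =>
    rw [aux_block]
    simp
    nlinarith
  | succ k ih =>
    rw [aux_block]
    have h1 : p ^ (padicValNat p ((p * k) !) + 2) ≤ p ^ (padicValNat p ((p * (k + 1)) !) + 1) :=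
      Nat.pow_le_pow_right (by omega) (by have := aux_mono_s5 p k; omega)
    have h3 : 2 * p ^ (padicValNat p ((p * (k + 1)) !) + 1) ≤
        p * p ^ (padicValNat p ((p * (k + 1)) !) + 1) := Nat.mul_le_mul_right _ h2
    have h4 : p * p ^ (padicValNat p ((p * (k + 1)) !) + 1) =
      p ^ (padicValNat p ((p * (k + 1)) !) + 2) := by ring
    have h5 : p * p ^ (padicValNat p ((p * (k + 1)) !)) =
      p ^ (padicValNat p ((p * (k + 1)) !) + 1) := by ring
    omega

theorem partial_sum_digits_length (p : ℕ) (hp : p.Prime) (k : ℕ) (n : ℕ)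
    (hn : n = (k + 1) * p - 1) :
    (Nat.digits p (∑ m ∈ Finset.range (n + 1), p ^ (padicValNat p (m !)))).length =
      padicValNat p (n !) + 2 := by
  haveI : Fact p.Prime := ⟨hp⟩
  have h2 := hp.two_le
  have e : n = p * k + (p - 1) := by
    rw [hn, add_mul, mul_comm k p]; omega
  have e1 : n + 1 = p * (k + 1) := by
    rw [e, Nat.mul_succ]; omega
  have e2 : padicValNat p (n !) = padicValNat p ((p * k) !) := by
    rw [e, padicValNat_factorial_mul_add k (by omega)]
  rw [e1, e2]
  apply le_antisymm
  · exact (Nat.digits_length_le_iff (by omega) _).2 (aux_lt p k)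
  · refine (Nat.lt_digits_length_iff (by omega) _).2 ?_
    rw [aux_block, pow_succ']
    omega
end

section
/- Let p be a prime and r ≥ 3. Then the base-p expansion of the partial sum S := ∑_{m=0}^{p^r} p^{v_p(m!)} begins (in its most significant digits) with 1 followed by a string of r − 2 zeroes: there exists a list L of natural numbers with L.length = v_p((p^r − 1)!) + 2 such that Nat.digits p S = L ++ List.replicate (r − 2) 0 ++ [1]. -/
open Nat

theorem aux_block_bound (p : ℕ) (hp : p.Prime) (k : ℕ) :
    ∑ m ∈ Finset.range (p * k + p), p ^ (padicValNat p (m !)) <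
      p ^ (padicValNat p ((p * k)!) + 2) := by
  have : Fact p.Prime := ⟨hp⟩
  have h2 := hp.two_le
  have block : ∀ k, ∑ j ∈ Finset.range p, p ^ (padicValNat p ((p * k + j)!)) =
      p ^ (padicValNat p ((p * k)!) + 1) := by
    intro k
    rw [Finset.sum_congr rfl (g := fun _ => p ^ (padicValNat p ((p * k)!)))]
    · simp [pow_succ, mul_comm]
    · intro j hj
      rw [padicValNat_factorial_mul_add k (Finset.mem_range.1 hj)]
  induction k with
  | zero =>
    rw [Finset.sum_range_add, block]
    simp
    nlinarith
  | succ k ih =>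
    rw [Finset.sum_range_add, block]
    have e : padicValNat p ((p * k)!) + 1 ≤ padicValNat p ((p * (k+1))!) := by
      rw [padicValNat_factorial_mul, padicValNat_factorial_mul, Nat.factorial_succ,
        padicValNat.mul (by omega) (Nat.factorial_ne_zero _)]
      omega
    have h3 : p ^ (padicValNat p ((p * k)!) + 2) ≤ p ^ (padicValNat p ((p * (k+1))!) + 1) :=
      Nat.pow_le_pow_right hp.pos (by omega)
    have h4 : p ^ (padicValNat p ((p * (k+1))!) + 2) =
      p ^ (padicValNat p ((p * (k+1))!) + 1) * p := pow_succ _ _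
    rw [h4, mul_add p k 1, mul_one]
    rw [mul_add p k 1, mul_one] at h3
    have h5 := Nat.mul_le_mul_left (p ^ (padicValNat p ((p * k + p)!) + 1)) h2
    omega

theorem digits_partial_sum_leading_one_zeros (p : ℕ) (hp : p.Prime) (r : ℕ) (hr : 3 ≤ r) :
    ∃ L : List ℕ, L.length = padicValNat p ((p ^ r - 1)!) + 2 ∧
      Nat.digits p (∑ m ∈ Finset.range (p ^ r + 1), p ^ (padicValNat p (m !))) =
        L ++ List.replicate (r - 2) 0 ++ [1] := by
  have : Fact p.Prime := ⟨hp⟩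
  have h2 := hp.two_le
  obtain ⟨s, rfl⟩ : ∃ s, r = s + 1 := ⟨r - 1, by omega⟩
  have hpos : 0 < p ^ s := pow_pos hp.pos s
  obtain ⟨k, hk⟩ : ∃ k, p ^ s = k + 1 := ⟨p ^ s - 1, by omega⟩
  have hpr : p ^ (s + 1) = p * k + p := by rw [pow_succ, hk]; ring
  have hv : padicValNat p ((p ^ (s + 1) - 1)!) = padicValNat p ((p * k)!) := by
    rw [hpr, Nat.add_sub_assoc (by omega), padicValNat_factorial_mul_add k (by omega)]
  have hlast : padicValNat p ((p ^ (s + 1))!) = padicValNat p ((p ^ (s + 1) - 1)!) + (s + 1) := by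
    have h0 : p ^ (s + 1) ≠ 0 := (pow_pos hp.pos _).ne'
    rw [← Nat.mul_factorial_pred h0, padicValNat.mul h0 (Nat.factorial_ne_zero _),
      padicValNat.prime_pow, add_comm]
  have hT := aux_block_bound p hp k
  rw [← hpr, ← hv] at hT
  rw [Finset.sum_range_succ, hlast]
  generalize padicValNat p ((p ^ (s + 1) - 1)!) = v at *
  generalize ∑ m ∈ Finset.range (p ^ (s + 1)), p ^ (padicValNat p (m !)) = T at *
  have hlen : (Nat.digits p T).length ≤ v + 2 :=
    (Nat.digits_length_le_iff h2 T).2 hT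
  refine ⟨Nat.digits p T ++ List.replicate (v + 2 - (Nat.digits p T).length) 0, by simp; omega, ?_⟩
  rw [List.append_assoc (Nat.digits p T), List.replicate_append_replicate]
  have h1 : [1] = Nat.digits p 1 := (Nat.digits_of_lt p 1 one_ne_zero h2).symm
  rw [h1, Nat.digits_append_zeroes_append_digits (by omega) (by omega), mul_one]
  congr 3
  omega
end

section
/- Let p be a prime, r ≥ 3, and set v := v_p((p^r)!). Then the string of zero digits created at step p^r is fixed in all subsequent partial sums: for every N ≥ p^r and every index i with v − r + 2 ≤ i ≤ v − 1, the i-th base-p digit of ∑_{m=0}^{N} p^{v_p(m!)} is 0, i.e. (Nat.digits p (∑_{m=0}^{N} p^{v_p(m!)})).getD i 0 = 0. -/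
open Nat

lemma aux_sum (p : ℕ) (hp : p.Prime) (n : ℕ) :
    ∑ m ∈ Finset.range (p * (n + 1)), p ^ (padicValNat p (m !))
      < p ^ (padicValNat p ((p * n)!) + 2) := by
  have := Fact.mk hp
  have h2 := hp.two_le
  have block : ∀ n : ℕ, ∑ j ∈ Finset.range p, p ^ (padicValNat p ((p * n + j)!))
      = p ^ (padicValNat p ((p * n)!) + 1) := by
    intro n
    rw [Finset.sum_congr rfl (g := fun _ => p ^ (padicValNat p ((p * n)!)))]
    · simp [pow_succ, mul_comm]
    · intro j hj
      rw [padicValNat_factorial_mul_add n (Finset.mem_range.1 hj)]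
  induction n with
  | zero =>
    have := block 0
    simp only [mul_zero, zero_add] at this
    rw [zero_add, mul_one, this, mul_zero]
    exact Nat.pow_lt_pow_right hp.one_lt (by omega)
  | succ n ih =>
    rw [mul_add p (n + 1) 1, mul_one, Finset.sum_range_add, block]
    have hmono : padicValNat p ((p * n)!) + 1 ≤ padicValNat p ((p * (n + 1))!) := by
      rw [padicValNat_factorial_mul, padicValNat_factorial_mul, Nat.factorial_succ,
        padicValNat.mul (by omega) (Nat.factorial_ne_zero n)]
      omega
    have h3 : p ^ (padicValNat p ((p * n)!) + 2) ≤ p ^ (padicValNat p ((p * (n + 1))!) + 1) :=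
      Nat.pow_le_pow_right hp.pos (by omega)
    have h4 : p ^ (padicValNat p ((p * (n + 1))!) + 2)
        = p * p ^ (padicValNat p ((p * (n + 1))!) + 1) := by ring
    rw [h4]
    nlinarith [Nat.mul_le_mul_right (p ^ (padicValNat p ((p * (n + 1))!) + 1)) h2]

theorem zero_digits_persist (p : ℕ) (hp : p.Prime) (r : ℕ) (hr : 3 ≤ r) :
    ∀ N : ℕ, p ^ r ≤ N → ∀ i : ℕ,
      padicValNat p ((p ^ r)!) - r + 2 ≤ i → i ≤ padicValNat p ((p ^ r)!) - 1 →
      (Nat.digits p (∑ m ∈ Finset.range (N + 1), p ^ (padicValNat p (m !)))).getD i 0 = 0 := by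
  have := Fact.mk hp
  intro N hN i hi1 hi2
  obtain ⟨s, rfl⟩ : ∃ s, r = s + 1 := ⟨r - 1, by omega⟩
  obtain ⟨n, hn⟩ : ∃ n, p ^ s = n + 1 := ⟨p ^ s - 1, by have := Nat.pow_pos (n := s) hp.pos; omega⟩
  have hpr : p ^ (s + 1) = p * (n + 1) := by rw [pow_succ, hn, mul_comm]
  have hv : padicValNat p ((p ^ (s + 1))!) = padicValNat p ((p * n)!) + (s + 1) := by
    have e : p ^ (s + 1) = (p * n + (p - 1)) + 1 := by
      rw [hpr, mul_add]; have := hp.pos; omega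
    rw [e, Nat.factorial_succ, padicValNat.mul (by omega) (Nat.factorial_ne_zero _),
      padicValNat_factorial_mul_add n (by have := hp.pos; omega), ← e, padicValNat.prime_pow]
    omega
  have hA := aux_sum p hp n
  rw [← hpr] at hA
  generalize hvv : padicValNat p ((p ^ (s + 1))!) = v at *
  have hK : p ^ v ∣ ∑ m ∈ Finset.range (N + 1 - p ^ (s + 1)),
      p ^ (padicValNat p ((p ^ (s + 1) + m)!)) := by
    apply Finset.dvd_sum
    intro m _
    apply pow_dvd_pow
    rw [← hvv]
    rw [← padicValNat_dvd_iff_le (Nat.factorial_ne_zero _)]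
    exact pow_padicValNat_dvd.trans (Nat.factorial_dvd_factorial (by omega))
  obtain ⟨K, hK⟩ := hK
  have hS : ∑ m ∈ Finset.range (N + 1), p ^ (padicValNat p (m !))
      = ∑ m ∈ Finset.range (p ^ (s + 1)), p ^ (padicValNat p (m !)) + p ^ v * K := by
    rw [← hK, ← Finset.sum_range_add]
    congr 2
    omega
  rw [hS, Nat.getD_digits _ _ hp.two_le]
  have hlt : ∑ m ∈ Finset.range (p ^ (s + 1)), p ^ (padicValNat p (m !)) < p ^ i :=
    hA.trans_le (Nat.pow_le_pow_right hp.pos (by omega))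
  obtain ⟨d, rfl⟩ : ∃ d, v = i + (d + 1) := ⟨v - i - 1, by omega⟩
  rw [pow_add p i (d + 1), mul_assoc, Nat.add_mul_div_left _ _ (Nat.pow_pos hp.pos), Nat.div_eq_of_lt hlt,
    zero_add, pow_succ, mul_comm (p ^ d) p, mul_assoc]
  exact Nat.mul_mod_right _ _
end
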